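/- Let Λ be a lattice of full rank in ℝ^d and let B be a symmetric convex body in ℝ^d with successive minima 0 < λ_1 ≤ λ_2 ≤ ⋯ ≤ λ_d of B with respect to Λ. Then the number of lattice points of Λ lying in B satisfies |Λ ∩ B| ≤ C(d)·Π_{j=1}^{d} max{1, λ_j^{−1}} for a constant C(d) depending only on d. -/

import Mathlib

open scoped Pointwise

/-- The `j`-th successive minimum (with `j` running over `Fin d`, so `sucMin B Λ j`
is the `(j+1)`-st minimum in the classical 1-based indexing): the infimum of those
`t > 0` such that `t • B` contains `j+1` linearly independent elements of `Λ`. -/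
noncomputable def sucMin {d : ℕ} (B : Set (EuclideanSpace ℝ (Fin d)))
    (Λ : Submodule ℤ (EuclideanSpace ℝ (Fin d))) (j : Fin d) : ℝ :=
  sInf {t : ℝ | 0 < t ∧ ∃ v : Fin (j.val + 1) → EuclideanSpace ℝ (Fin d),
    (∀ i, v i ∈ Λ) ∧ LinearIndependent ℝ v ∧ ∀ i, v i ∈ t • B}

/-- A finite subset of a free `ℤ`-module of rank at most `n` can be covered by `q ^ n` cosets of
the multiples of `q`; hence if every part of it lying in one such coset has at most `N` elements,
it has at most `N * q ^ n` elements. -/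
theorem card_le_mul_pow_of_card_coset_le {E : Type*} [AddCommGroup E] (M : Submodule ℤ E)
    [Module.Free ℤ M] [Module.Finite ℤ M] {n : ℕ} (hn : Module.finrank ℤ M ≤ n)
    {q : ℕ} (hq : 0 < q) (T : Finset E) (hT : ∀ x ∈ T, x ∈ M) (N : ℕ)
    (hN : ∀ F ⊆ T, (∀ x ∈ F, ∀ y ∈ F, ∃ z ∈ M, x - y = q • z) → F.card ≤ N) :
    T.card ≤ N * q ^ n := by
  classical
  have : NeZero q := ⟨hq.ne'⟩
  let b := Module.finBasis ℤ M
  let f : E → (Fin (Module.finrank ℤ M) → ZMod q) := fun x i =>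
    if h : x ∈ M then ((b.repr ⟨x, h⟩ i : ℤ) : ZMod q) else 0
  have h1 : T.card ≤ N * (Finset.univ : Finset (Fin (Module.finrank ℤ M) → ZMod q)).card := by
    refine Finset.card_le_mul_card_image_of_maps_to (f := f) (fun _ _ => Finset.mem_univ _) N ?_
    intro c _
    refine hN _ (Finset.filter_subset _ _) ?_
    intro x hx y hy
    rw [Finset.mem_filter] at hx hy
    have hxM := hT x hx.1
    have hyM := hT y hy.1
    have key : ∀ i, ∃ w : ℤ, b.repr ⟨x, hxM⟩ i - b.repr ⟨y, hyM⟩ i = q * w := by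
      intro i
      have h2 : f x i = f y i := by rw [hx.2, hy.2]
      simp only [f, hxM, hyM, dif_pos] at h2
      have h3 : (((b.repr ⟨x, hxM⟩ i - b.repr ⟨y, hyM⟩ i : ℤ)) : ZMod q) = 0 := by
        push_cast
        rw [h2, sub_self]
      exact (ZMod.intCast_zmod_eq_zero_iff_dvd _ q).1 h3
    choose w hw using key
    refine ⟨(b.equivFun.symm w : M), Subtype.coe_prop _, ?_⟩
    have h4 : (⟨x, hxM⟩ - ⟨y, hyM⟩ : M) = q • b.equivFun.symm w := by
      apply b.equivFun.injective
      funext i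
      rw [map_sub, map_nsmul, LinearEquiv.apply_symm_apply]
      simpa using hw i
    simpa using congrArg Subtype.val h4
  refine h1.trans (Nat.mul_le_mul_left _ ?_)
  rw [Finset.card_univ, Fintype.card_fun, ZMod.card, Fintype.card_fin]
  exact Nat.pow_le_pow_right hq hn

/-- Counting along a family of submodules `M i` of rank at most `i`: if a point of `Λ` whose
`q i`-th multiple lies in `D` is forced into `M i`, where each later `q j` divides the earlier
ones, then a finite subset of `M k` with differences in `D` has at most `∏ i < k, q i` elements. -/
theorem card_le_prod_of_forall_sub_mem {E : Type*} [AddCommGroup E] (Λ : Submodule ℤ E)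
    (M : ℕ → Submodule ℤ E) [∀ i, Module.Free ℤ (M i)] [∀ i, Module.Finite ℤ (M i)]
    (hrank : ∀ i, Module.finrank ℤ (M i) ≤ i) (hMΛ : ∀ i, M i ≤ Λ) (k : ℕ) :
    ∀ (q : ℕ → ℕ) (D : Set E), (∀ i < k, 0 < q i) → (∀ i j, i ≤ j → j < k → q j ∣ q i) →
      (∀ i < k, ∀ x ∈ Λ, q i • x ∈ D → x ∈ M i) →
      ∀ T : Finset E, (∀ x ∈ T, x ∈ M k) → (∀ x ∈ T, ∀ y ∈ T, x - y ∈ D) →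
        T.card ≤ ∏ i ∈ Finset.range k, q i := by
  classical
  induction k with
  | zero =>
    intro q D _ _ _ T hT _
    have h0 : M 0 = ⊥ := by
      have := Module.finrank_zero_iff.1 (Nat.le_zero.1 (hrank 0))
      exact Submodule.subsingleton_iff_eq_bot.1 this
    simp only [Finset.range_zero, Finset.prod_empty]
    refine Finset.card_le_one.2 fun x hx y hy => ?_
    have h1 := hT x hx
    have h2 := hT y hy
    rw [h0, Submodule.mem_bot] at h1 h2
    rw [h1, h2]
  | succ k ih =>
    intro q D hq hdvd hD T hT hTD
    have hdvd' : ∀ i ≤ k, q k ∣ q i := fun i hi => hdvd i k hi (Nat.lt_succ_self k)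
    have hprod : ∏ i ∈ Finset.range (k + 1), q i =
        (∏ i ∈ Finset.range k, q i / q k) * q k ^ (k + 1) := by
      rw [Finset.prod_range_succ, pow_succ, ← mul_assoc]
      congr 1
      have : q k ^ k = ∏ _i ∈ Finset.range k, q k := by simp
      rw [this, ← Finset.prod_mul_distrib]
      refine Finset.prod_congr rfl fun i hi => ?_
      exact (Nat.div_mul_cancel (hdvd' i (Finset.mem_range.1 hi).le)).symm
    rw [hprod]
    refine card_le_mul_pow_of_card_coset_le (M (k + 1)) (hrank _) (hq k k.lt_succ_self) T hT _ ?_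
    intro F hFT hF
    rcases F.eq_empty_or_nonempty with rfl | ⟨t, ht⟩
    · simp
    choose! z hzM hz using fun x hx => hF x hx t ht
    have hzsub : ∀ x ∈ F, ∀ y ∈ F, q k • (z x - z y) = x - y := by
      intro x hx y hy
      rw [smul_sub, ← hz x hx, ← hz y hy]
      abel
    have hmem : ∀ x ∈ F, ∀ y ∈ F, z x - z y ∈ M k := by
      intro x hx y hy
      refine hD k (Nat.lt_succ_self k) _
        (hMΛ (k + 1) (Submodule.sub_mem _ (hzM x hx) (hzM y hy))) ?_
      rw [hzsub x hx y hy]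
      exact hTD x (hFT hx) y (hFT hy)
    have hinj : Set.InjOn (fun x => z x - z t) F := by
      intro x hx y hy hxy
      have : z x = z y := sub_left_injective hxy
      have h5 := hzsub x hx y hy
      rw [this, sub_self, smul_zero] at h5
      exact (sub_eq_zero.1 h5.symm)
    rw [← Finset.card_image_of_injOn hinj]
    refine ih (fun i => q i / q k) {x | q k • x ∈ D} ?_ ?_ ?_ _ ?_ ?_
    · exact fun i hi => Nat.div_pos
        (Nat.le_of_dvd (hq i (by lia)) (hdvd' i hi.le)) (hq k k.lt_succ_self)
    · exact fun i j hij hj => Nat.div_dvd_div (hdvd' j hj.le) (hdvd i j hij (by lia))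
    · intro i hi x hx hxD
      refine hD i (by lia) x hx ?_
      rw [Set.mem_ofPred_eq, ← mul_smul, Nat.mul_div_cancel' (hdvd' i hi.le)] at hxD
      exact hxD
    · intro x hx
      obtain ⟨y, hy, rfl⟩ := Finset.mem_image.1 hx
      exact hmem y hy t ht
    · intro x hx y hy
      obtain ⟨u, hu, rfl⟩ := Finset.mem_image.1 hx
      obtain ⟨w, hw, rfl⟩ := Finset.mem_image.1 hy
      rw [sub_sub_sub_cancel_right, Set.mem_ofPred_eq, hzsub u hu w hw]
      exact hTD u (hFT hu) w (hFT hw)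

/-- Sufficiently small dilates of a bounded set contain no nonzero point of a discrete
subgroup. -/
theorem exists_pos_le_of_mem_smul {E : Type*} [NormedAddCommGroup E] [NormedSpace ℝ E]
    (Λ : Submodule ℤ E) [DiscreteTopology Λ] {B : Set E} (hB : Bornology.IsBounded B) :
    ∃ c : ℝ, 0 < c ∧ ∀ t : ℝ, 0 < t → ∀ x ∈ Λ, x ≠ 0 → x ∈ t • B → c ≤ t := by
  obtain ⟨R, hR, hBR⟩ := hB.exists_pos_norm_le
  obtain ⟨ε, hε, hball⟩ := Metric.isOpen_iff.1 (isOpen_discrete ({0} : Set Λ)) 0 rfl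
  refine ⟨ε / R, div_pos hε hR, fun t ht x hx hx0 hxB => ?_⟩
  obtain ⟨y, hy, rfl⟩ := hxB
  have h1 : ε ≤ ‖t • y‖ := by
    by_contra! h
    have h2 : (⟨t • y, hx⟩ : Λ) ∈ Metric.ball (0 : Λ) ε := by
      rw [mem_ball_zero_iff]
      exact h
    exact hx0 (congrArg Subtype.val (hball h2))
  rw [norm_smul, Real.norm_of_nonneg ht.le] at h1
  rw [div_le_iff₀ hR]
  exact h1.trans (mul_le_mul_of_nonneg_left (hBR y hy) ht.le)

section SucMin

variable {d : ℕ} {B : Set (EuclideanSpace ℝ (Fin d))} {Λ : Submodule ℤ (EuclideanSpace ℝ (Fin d))}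

theorem bddBelow_sucMin_set (j : Fin d) :
    BddBelow {t : ℝ | 0 < t ∧ ∃ v : Fin (j.val + 1) → EuclideanSpace ℝ (Fin d),
      (∀ i, v i ∈ Λ) ∧ LinearIndependent ℝ v ∧ ∀ i, v i ∈ t • B} :=
  ⟨0, fun _ ht => ht.1.le⟩

theorem exists_pos_linearIndependent_mem_smul [DiscreteTopology Λ] [IsZLattice ℝ Λ]
    (hB : B ∈ nhds 0) (j : Fin d) :
    {t : ℝ | 0 < t ∧ ∃ v : Fin (j.val + 1) → EuclideanSpace ℝ (Fin d),
      (∀ i, v i ∈ Λ) ∧ LinearIndependent ℝ v ∧ ∀ i, v i ∈ t • B}.Nonempty := by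
  obtain ⟨v, hv, -, hli⟩ := Submodule.exists_fun_fin_finrank_span_eq ℝ (Λ : Set (EuclideanSpace ℝ (Fin d)))
  have hrk : j.val + 1 ≤ Module.finrank ℝ
      (Submodule.span ℝ (Λ : Set (EuclideanSpace ℝ (Fin d)))) := by
    rw [IsZLattice.span_top, finrank_top, finrank_euclideanSpace_fin]
    exact j.2
  have habs : ∀ i, ∀ᶠ c : ℝ in Filter.atTop, v i ∈ c • B := fun i => by
    have h := ((absorbent_nhds_zero (𝕜 := ℝ) hB).absorbs (x := v i)).eventually
    have h' := h.filter_mono IsOrderBornology.atTop_le_cobounded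
    filter_upwards [h'] with c hc using hc rfl
  obtain ⟨t, ht, ht0⟩ := ((Filter.eventually_all.2 habs).and (Filter.eventually_gt_atTop 0)).exists
  exact ⟨t, ht0, v ∘ Fin.castLE hrk, fun i => hv _, hli.comp _ (Fin.castLE_injective hrk),
    fun i => ht _⟩

theorem sucMin_pos [DiscreteTopology Λ] [IsZLattice ℝ Λ] (hB : B ∈ nhds 0)
    (hbd : Bornology.IsBounded B) (j : Fin d) : 0 < sucMin B Λ j := by
  obtain ⟨c, hc, h⟩ := exists_pos_le_of_mem_smul Λ hbd
  refine hc.trans_le (le_csInf (exists_pos_linearIndependent_mem_smul hB j) ?_)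
  rintro t ⟨ht, v, hv, hli, hvB⟩
  exact h t ht (v 0) (hv 0) (hli.ne_zero 0) (hvB 0)

theorem sucMin_mono [DiscreteTopology Λ] [IsZLattice ℝ Λ] (hB : B ∈ nhds 0) :
    Monotone (sucMin B Λ) := by
  intro i j hij
  refine csInf_le_csInf (bddBelow_sucMin_set i) (exists_pos_linearIndependent_mem_smul hB j) ?_
  rintro t ⟨ht, v, hv, hli, hvB⟩
  have hle : i.val + 1 ≤ j.val + 1 := Nat.succ_le_succ hij
  exact ⟨ht, v ∘ Fin.castLE hle, fun _ => hv _, hli.comp _ (Fin.castLE_injective hle),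
    fun _ => hvB _⟩

/-- Lattice points lying in a dilate of `B` by less than the `j`-th successive minimum
(0-based) span a space of dimension at most `j`. -/
theorem finrank_span_le_of_lt_sucMin {j : Fin d} {t : ℝ} (ht : 0 < t) (htj : t < sucMin B Λ j) :
    Set.finrank ℝ {x | x ∈ Λ ∧ x ∈ t • B} ≤ j := by
  by_contra! h
  obtain ⟨v, hv, -, hli⟩ := Submodule.exists_fun_fin_finrank_span_eq ℝ {x | x ∈ Λ ∧ x ∈ t • B}
  refine htj.not_ge (csInf_le (bddBelow_sucMin_set j) ⟨ht, v ∘ Fin.castLE h, fun i => (hv _).1,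
    hli.comp _ (Fin.castLE_injective h), fun i => (hv _).2⟩)

end SucMin

/-- A power of two just above `2 / l`, with exponent depending antitonically on `l`. -/
theorem exists_antitoneOn_two_pow :
    ∃ a : ℝ → ℕ, AntitoneOn a (Set.Ioi 0) ∧
      ∀ l > 0, 2 < 2 ^ a l * l ∧ (2 : ℝ) ^ a l ≤ 4 * max 1 l⁻¹ := by
  have hex : ∀ l : ℝ, 0 < l → ∃ n : ℕ, 2 < 2 ^ n * l := fun l hl => by
    obtain ⟨n, hn⟩ := pow_unbounded_of_one_lt (2 / l) one_lt_two
    exact ⟨n, (div_lt_iff₀ hl).1 hn⟩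
  refine ⟨fun l => sInf {n : ℕ | (2 : ℝ) < 2 ^ n * l}, ?_, ?_⟩
  · intro l hl m hm hlm
    refine Nat.sInf_le ?_
    have h : (2 : ℝ) < 2 ^ sInf {n : ℕ | (2 : ℝ) < 2 ^ n * l} * l := Nat.sInf_mem (hex l hl)
    exact h.trans_le (mul_le_mul_of_nonneg_left hlm (by positivity))
  · intro l hl
    refine ⟨Nat.sInf_mem (hex l hl), ?_⟩
    dsimp only
    cases hb : sInf {n : ℕ | (2 : ℝ) < 2 ^ n * l} with
    | zero =>
      have := le_max_left 1 l⁻¹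
      rw [pow_zero]
      linarith
    | succ b =>
      have hbn : ¬ (2 : ℝ) < 2 ^ b * l := fun h => by
        have := Nat.sInf_le (s := {n : ℕ | (2 : ℝ) < 2 ^ n * l}) h
        lia
      have h2 : (2 : ℝ) ^ b ≤ 2 * l⁻¹ := by
        rw [← div_eq_mul_inv, le_div_iff₀ hl]
        exact not_lt.1 hbn
      have := le_max_right 1 l⁻¹
      rw [pow_succ]
      linarith

/-- lattice point counting: for a full-rank lattice `Λ ⊆ ℝ^d` and a
symmetric convex body `B` with successive minima `λ₁ ≤ ⋯ ≤ λ_d`, one has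
`|Λ ∩ B| ≤ C(d)·∏ⱼ max{1, λⱼ⁻¹}`. -/
theorem stmt_7 (d : ℕ) (hd : 1 ≤ d) :
    ∃ C : ℝ, 0 < C ∧
      ∀ (Λ : Submodule ℤ (EuclideanSpace ℝ (Fin d)))
        [DiscreteTopology Λ] [IsZLattice ℝ Λ]
        (B : Set (EuclideanSpace ℝ (Fin d))),
        Convex ℝ B → IsCompact B → B = -B → (interior B).Nonempty →
        (((Λ : Set (EuclideanSpace ℝ (Fin d))) ∩ B).ncard : ℝ) ≤
          C * ∏ j : Fin d, max 1 (sucMin B Λ j)⁻¹ := by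
  refine ⟨4 ^ d, by positivity, ?_⟩
  intro Λ _ _ B hconv hcomp hsymm hint
  have hB : B ∈ nhds 0 := by
    obtain ⟨x, hx⟩ := hint
    have hx' : -x ∈ interior B := by
      have h : interior B = -interior B := by
        conv_lhs => rw [hsymm]
        exact ((Homeomorph.neg _).preimage_interior B).symm
      rw [h]
      simpa using hx
    have h0 := hconv.interior hx hx' (by norm_num : (0 : ℝ) ≤ 1 / 2)
      (by norm_num : (0 : ℝ) ≤ 1 / 2) (by norm_num)
    rw [smul_neg, add_neg_cancel] at h0
    exact mem_interior_iff_mem_nhds.1 h0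
  have hbd := hcomp.isBounded
  have hfin : ((Λ : Set (EuclideanSpace ℝ (Fin d))) ∩ B).Finite := by
    rw [Set.inter_comm]
    refine Metric.finite_isBounded_inter_isClosed DiscreteTopology.isDiscrete hbd ?_
    exact AddSubgroup.isClosed_of_discrete (H := Λ.toAddSubgroup)
  obtain ⟨a, ha, ha'⟩ := exists_antitoneOn_two_pow
  have hpos := sucMin_pos (Λ := Λ) hB hbd
  let q : ℕ → ℕ := fun i => if h : i < d then 2 ^ a (sucMin B Λ ⟨i, h⟩) else 1
  let M : ℕ → Submodule ℤ (EuclideanSpace ℝ (Fin d)) := fun i =>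
    if i < d then Submodule.span ℤ {x | x ∈ Λ ∧ x ∈ ((2 : ℝ) / q i) • B} else Λ
  have hMi : ∀ i < d, M i = Submodule.span ℤ {x | x ∈ Λ ∧ x ∈ ((2 : ℝ) / q i) • B} :=
    fun i hi => if_pos hi
  have hMΛ : ∀ i, M i ≤ Λ := by
    intro i
    simp only [M]
    split_ifs
    · exact Submodule.span_le.2 fun x hx => hx.1
    · exact le_rfl
  have hdisc : ∀ i, DiscreteTopology (M i) := fun i =>
    DiscreteTopology.of_subset (s := (Λ : Set _)) inferInstance (hMΛ i)
  have hMfin : ∀ i, Module.Finite ℤ (M i) := fun i => inferInstance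
  have hMfree : ∀ i, Module.Free ℤ (M i) := fun i => inferInstance
  have hq : ∀ i, 0 < q i := by
    intro i
    simp only [q]
    split_ifs <;> positivity
  have hrank : ∀ i, Module.finrank ℤ (M i) ≤ i := by
    intro i
    by_cases hi : i < d
    · have hd' := hdisc i
      rw [hMi i hi] at hd' ⊢
      change Set.finrank ℤ _ ≤ i
      rw [← Real.finrank_eq_int_finrank_of_discrete hd']
      refine finrank_span_le_of_lt_sucMin (j := ⟨i, hi⟩) (div_pos two_pos (mod_cast hq i)) ?_
      rw [div_lt_iff₀ (mod_cast hq i), mul_comm]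
      simpa [q, hi] using (ha' _ (hpos ⟨i, hi⟩)).1
    · rw [show M i = Λ from if_neg hi, ZLattice.rank ℝ Λ, finrank_euclideanSpace_fin]
      exact not_lt.1 hi
  have hMd : M d = Λ := by simp [M]
  have hcard := card_le_prod_of_forall_sub_mem Λ M hrank hMΛ d q ((2 : ℝ) • B) (fun i _ => hq i)
    ?_ ?_ hfin.toFinset ?_ ?_
  · rw [Set.ncard_eq_toFinset_card _ hfin]
    calc (hfin.toFinset.card : ℝ) ≤ ((∏ i ∈ Finset.range d, q i : ℕ) : ℝ) := mod_cast hcard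
      _ = ∏ j : Fin d, (2 : ℝ) ^ a (sucMin B Λ j) := by
        rw [Finset.prod_range]
        simp [q]
      _ ≤ ∏ j : Fin d, 4 * max 1 (sucMin B Λ j)⁻¹ :=
        Finset.prod_le_prod (fun _ _ => by positivity) fun j _ => (ha' _ (hpos j)).2
      _ = 4 ^ d * ∏ j : Fin d, max 1 (sucMin B Λ j)⁻¹ := by
        simp [Finset.prod_mul_distrib]
  · intro i j hij hj
    simp only [q, hj, hij.trans_lt hj, dif_pos]
    exact pow_dvd_pow 2 (ha (hpos _) (hpos _) (sucMin_mono hB hij))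
  · intro i hi x hx hxD
    rw [hMi i hi]
    refine Submodule.subset_span ⟨hx, ?_⟩
    have hq0 : (q i : ℝ) ≠ 0 := mod_cast (hq i).ne'
    obtain ⟨y, hy, hxy⟩ := hxD
    refine ⟨y, hy, ?_⟩
    have hxy' : (2 : ℝ) • y = (q i : ℝ) • x := by
      rw [Nat.cast_smul_eq_nsmul]
      exact hxy
    change ((2 : ℝ) / q i) • y = x
    rw [div_eq_inv_mul, mul_smul, hxy', inv_smul_smul₀ hq0]
  · intro x hx
    rw [hMd]
    exact (hfin.mem_toFinset.1 hx).1
  · intro x hx y hy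
    have hxB := (hfin.mem_toFinset.1 hx).2
    have hyB : -y ∈ B := by
      rw [hsymm]
      simpa using (hfin.mem_toFinset.1 hy).2
    refine ⟨_, hconv hxB hyB (by norm_num : (0 : ℝ) ≤ 1 / 2)
      (by norm_num : (0 : ℝ) ≤ 1 / 2) (by norm_num), ?_⟩
    simp [smul_add, smul_smul, sub_eq_add_neg]
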